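/- There exists a probability measure μ on the real line, concentrated on [0, ∞), such that for every real number t ≥ 0, ∫ exp(-t²·ω) dμ(ω) = exp(-γ·t)/Γ(t + 1), where γ is the Euler–Mascheroni constant. -/

import Mathlib

open Real MeasureTheory
open Filter Topology Set ProbabilityTheory

/-- The (unnormalised) error function `x ↦ ∫₀ˣ exp (-s²) ds`. -/
noncomputable def gaussPrimitive (x : ℝ) : ℝ := ∫ s in (0 : ℝ)..x, exp (-s ^ 2)

lemma hasDerivAt_gaussPrimitive (x : ℝ) : HasDerivAt gaussPrimitive (exp (-x ^ 2)) x :=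
  (Continuous.integral_hasStrictDerivAt (f := fun s : ℝ => exp (-s ^ 2))
    (by fun_prop) 0 x).hasDerivAt

lemma gaussPrimitive_neg (x : ℝ) : gaussPrimitive (-x) = -gaussPrimitive x := by
  have h := intervalIntegral.integral_comp_neg (a := 0) (b := x) (fun s : ℝ => exp (-s ^ 2))
  simp only [neg_sq, neg_zero] at h
  rw [gaussPrimitive, gaussPrimitive, h, intervalIntegral.integral_symm]

lemma tendsto_gaussPrimitive_atTop : Tendsto gaussPrimitive atTop (𝓝 (√π / 2)) := by
  have h1 := integral_gaussian_Ioi 1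
  have h2 := (integrable_exp_neg_mul_sq one_pos).integrableOn (s := Ioi (0 : ℝ))
  simp only [neg_mul, one_mul, div_one] at h1 h2
  rw [← h1]
  exact intervalIntegral_tendsto_integral_Ioi 0 h2 tendsto_id

lemma tendsto_gaussPrimitive_atBot : Tendsto gaussPrimitive atBot (𝓝 (-(√π / 2))) := by
  refine (tendsto_gaussPrimitive_atTop.comp tendsto_neg_atBot_atTop).neg.congr fun x => ?_
  simp [gaussPrimitive_neg]

/-- An antiderivative of `u ↦ 2 u² exp (-u² - a² / u²)` on `(0, ∞)`. -/
noncomputable def besselPrimitive (a u : ℝ) : ℝ :=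
  -(u * exp (-u ^ 2 - a ^ 2 / u ^ 2)) + (1 / 2 - a) * exp (2 * a) * gaussPrimitive (u + a / u) +
    (1 / 2 + a) * exp (-(2 * a)) * gaussPrimitive (u - a / u)

lemma hasDerivAt_besselPrimitive (a : ℝ) {u : ℝ} (hu : 0 < u) :
    HasDerivAt (besselPrimitive a) (2 * u ^ 2 * exp (-u ^ 2 - a ^ 2 / u ^ 2)) u := by
  have hd : HasDerivAt (fun u : ℝ => a / u) (-(a / u ^ 2)) u := by
    simpa [div_eq_mul_inv] using (hasDerivAt_inv hu.ne').const_mul a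
  have hd2 : HasDerivAt (fun u : ℝ => a ^ 2 / u ^ 2) (-(2 * a ^ 2 / u ^ 3)) u := by
    have h := (hd.pow 2).congr_deriv (g' := -(2 * a ^ 2 / u ^ 3)) (by norm_num; field_simp)
    simpa only [Pi.pow_def, div_pow] using h
  have hE := ((((hasDerivAt_pow 2 u).neg).sub hd2).exp)
  have hp := (hasDerivAt_gaussPrimitive (u + a / u)).comp u ((hasDerivAt_id u).add hd)
  have hm := (hasDerivAt_gaussPrimitive (u - a / u)).comp u ((hasDerivAt_id u).sub hd)
  have h := (((hasDerivAt_id u).mul hE).neg.add (hp.const_mul ((1 / 2 - a) * exp (2 * a)))).add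
    (hm.const_mul ((1 / 2 + a) * exp (-(2 * a))))
  have e1 : exp (2 * a) * exp (-(u + a / u) ^ 2) = exp (-u ^ 2 - a ^ 2 / u ^ 2) := by
    rw [← exp_add]; congr 1; field_simp; ring
  have e2 : exp (-(2 * a)) * exp (-(u - a / u) ^ 2) = exp (-u ^ 2 - a ^ 2 / u ^ 2) := by
    rw [← exp_add]; congr 1; field_simp; ring
  refine h.congr_deriv ?_
  have r1 : (1 / 2 - a) * exp (2 * a) * (exp (-(u + a / u) ^ 2) * (1 + -(a / u ^ 2))) =
      (1 / 2 - a) * (1 - a / u ^ 2) * exp (-u ^ 2 - a ^ 2 / u ^ 2) := by rw [← e1]; ring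
  have r2 : (1 / 2 + a) * exp (-(2 * a)) * (exp (-(u - a / u) ^ 2) * (1 - -(a / u ^ 2))) =
      (1 / 2 + a) * (1 + a / u ^ 2) * exp (-u ^ 2 - a ^ 2 / u ^ 2) := by rw [← e2]; ring
  rw [r1, r2]
  simp only [id, Pi.neg_apply, Pi.sub_apply]
  field_simp
  ring

lemma tendsto_besselPrimitive_atTop (a : ℝ) :
    Tendsto (besselPrimitive a) atTop (𝓝 (0 + (1 / 2 - a) * exp (2 * a) * (√π / 2) +
      (1 / 2 + a) * exp (-(2 * a)) * (√π / 2))) := by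
  have hd : Tendsto (fun u : ℝ => a / u) atTop (𝓝 0) := tendsto_id.const_div_atTop a
  refine (Tendsto.add ?_ ((tendsto_gaussPrimitive_atTop.comp ?_).const_mul _)).add
    ((tendsto_gaussPrimitive_atTop.comp ?_).const_mul _)
  · rw [← neg_zero]
    refine Tendsto.neg ?_
    have h := tendsto_rpow_mul_exp_neg_mul_atTop_nhds_zero 1 1 one_pos
    refine squeeze_zero' ?_ ?_ h
    · filter_upwards [eventually_ge_atTop 0] with u hu
      positivity
    · filter_upwards [eventually_ge_atTop 1] with u hu
      rw [rpow_one]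
      gcongr
      have : 0 ≤ a ^ 2 / u ^ 2 := by positivity
      nlinarith
  · exact tendsto_id.atTop_add hd
  · simpa [sub_eq_add_neg] using tendsto_id.atTop_add hd.neg

lemma tendsto_besselPrimitive_zero {a : ℝ} (ha : 0 < a) :
    Tendsto (besselPrimitive a) (𝓝[>] 0) (𝓝 (0 + (1 / 2 - a) * exp (2 * a) * (√π / 2) +
      (1 / 2 + a) * exp (-(2 * a)) * (-(√π / 2)))) := by
  have hd : Tendsto (fun u : ℝ => a / u) (𝓝[>] 0) atTop := by
    simpa [div_eq_mul_inv] using tendsto_inv_nhdsGT_zero.const_mul_atTop ha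
  have h0 : Tendsto (fun u : ℝ => u) (𝓝[>] 0) (𝓝 0) := nhdsWithin_le_nhds
  refine (Tendsto.add ?_ ((tendsto_gaussPrimitive_atTop.comp ?_).const_mul _)).add
    ((tendsto_gaussPrimitive_atBot.comp ?_).const_mul _)
  · suffices h : Tendsto (fun u => u * exp (-u ^ 2 - a ^ 2 / u ^ 2)) (𝓝[>] 0) (𝓝 0) by
      simpa using h.neg
    refine squeeze_zero' ?_ ?_ h0
    · filter_upwards [self_mem_nhdsWithin] with u (hu : 0 < u)
      positivity
    · filter_upwards [self_mem_nhdsWithin] with u (hu : 0 < u)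
      refine mul_le_of_le_one_right hu.le (exp_le_one_iff.2 ?_)
      have : 0 ≤ a ^ 2 / u ^ 2 := by positivity
      nlinarith
  · exact h0.add_atTop hd
  · simpa [sub_eq_add_neg] using h0.add_atBot (tendsto_neg_atTop_atBot.comp hd)

lemma integral_sqrt_mul_exp_neg_sub_div {a : ℝ} (ha : 0 < a) :
    ∫ y in Ioi (0 : ℝ), √y * exp (-y - a ^ 2 / y) = √π / 2 * ((1 + 2 * a) * exp (-(2 * a))) := by
  have hs : Tendsto (fun y : ℝ => √y) (𝓝[>] 0) (𝓝[>] 0) := by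
    refine tendsto_nhdsWithin_iff.2 ⟨?_, ?_⟩
    · simpa using (continuous_sqrt.tendsto (0 : ℝ)).mono_left nhdsWithin_le_nhds
    · filter_upwards [self_mem_nhdsWithin] with y hy using sqrt_pos.2 hy
  have hcont := continuousWithinAt_update_same.2
    (((tendsto_besselPrimitive_zero ha).comp hs).mono_left
      (nhdsWithin_mono _ fun y hy => lt_of_le_of_ne hy.1 (Ne.symm hy.2)))
  have h := integral_Ioi_of_hasDerivAt_of_nonneg (g' := fun y => √y * exp (-y - a ^ 2 / y))
    hcont (fun y (hy : 0 < y) => ?_) (fun y (hy : 0 < y) => by positivity)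
    (((tendsto_besselPrimitive_atTop a).comp tendsto_sqrt_atTop).congr' ?_)
  · rw [h, Function.update_self]
    ring
  · have h := (hasDerivAt_besselPrimitive a (sqrt_pos.2 hy)).comp y (hasDerivAt_sqrt hy.ne')
    refine (h.congr_of_eventuallyEq ?_).congr_deriv ?_
    · filter_upwards [lt_mem_nhds hy] with z hz
      exact Function.update_of_ne hz.ne' _ _
    · have := (sqrt_pos.2 hy).ne'
      rw [sq_sqrt hy.le]
      have e := sq_sqrt hy.le
      field_simp
      rw [e]
  · filter_upwards [eventually_gt_atTop 0] with z hz
    exact (Function.update_of_ne hz.ne' _ _).symm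

lemma integral_gammaMeasure {a r : ℝ} (ha : 0 < a) (hr : 0 < r) (f : ℝ → ℝ) :
    ∫ y, f y ∂gammaMeasure a r =
      ∫ y in Ioi 0, r ^ a / Gamma a * y ^ (a - 1) * exp (-(r * y)) * f y := by
  have hm : Measurable (gammaPDF a r) := (measurable_gammaPDFReal a r).ennreal_ofReal
  rw [gammaMeasure, integral_withDensity_eq_integral_toReal_smul hm
    (ae_of_all _ fun _ => ENNReal.ofReal_lt_top), ← integral_Ici_eq_integral_Ioi,
    ← integral_indicator measurableSet_Ici]
  congr 1 with y
  rw [gammaPDF, ENNReal.toReal_ofReal (gammaPDFReal_nonneg ha hr y), gammaPDFReal]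
  by_cases hy : 0 ≤ y <;> simp [hy]

lemma Gamma_three_halves : Gamma (3 / 2) = √π / 2 := by
  rw [show (3 / 2 : ℝ) = 1 / 2 + 1 by norm_num, Gamma_add_one (by norm_num), Gamma_one_half_eq]
  ring

lemma integral_exp_gammaMeasure_three_halves {t : ℝ} (ht : 0 < t) :
    ∫ y, exp (-t ^ 2 * (|y|⁻¹ / 4)) ∂gammaMeasure (3 / 2) 1 = (1 + t) * exp (-t) := by
  have h := integral_sqrt_mul_exp_neg_sub_div (half_pos ht)
  rw [integral_gammaMeasure (by norm_num) one_pos]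
  have hpi : √π ≠ 0 := by positivity
  calc _ = ∫ y in Ioi (0 : ℝ), 2 / √π * (√y * exp (-y - (t / 2) ^ 2 / y)) := by
        refine setIntegral_congr_fun measurableSet_Ioi fun y (hy : 0 < y) => ?_
        rw [Gamma_three_halves, one_rpow, show (3 / 2 - 1 : ℝ) = 1 / 2 by norm_num, ← sqrt_eq_rpow,
          abs_of_pos hy, mul_assoc (_ * _), ← exp_add]
        field_simp
        congr 1
        field_simp
        ring
    _ = _ := by
        rw [integral_const_mul, h]
        field_simp

lemma lintegral_inv_gammaMeasure_ne_top :
    ∫⁻ y, ENNReal.ofReal |y|⁻¹ ∂gammaMeasure (3 / 2) 1 ≠ ⊤ := by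
  have hm : Measurable (gammaPDF (3 / 2) 1) := (measurable_gammaPDFReal _ _).ennreal_ofReal
  have hi : Integrable (fun y : ℝ => |y|⁻¹) (gammaMeasure (3 / 2) 1) := by
    rw [gammaMeasure, integrable_withDensity_iff hm (ae_of_all _ fun _ => ENNReal.ofReal_lt_top)]
    have h := ((GammaIntegral_convergent (s := 1 / 2) (by norm_num)).const_mul
      (Gamma (3 / 2))⁻¹)
    rw [← IntegrableOn, ← integrable_indicator_iff measurableSet_Ioi] at h
    refine h.congr (ae_of_all _ fun y => ?_)
    simp only [gammaPDF]
    rw [ENNReal.toReal_ofReal (gammaPDFReal_nonneg (by norm_num) one_pos y), gammaPDFReal]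
    rcases lt_trichotomy y 0 with hy | rfl | hy
    · simp [hy.not_ge, hy.le]
    · simp
    · rw [indicator_of_mem (mem_Ioi.2 hy), if_pos hy.le, abs_of_pos hy,
        show (3 / 2 - 1 : ℝ) = 1 / 2 - 1 + 1 by norm_num, rpow_add_one hy.ne']
      simp
      field_simp
  exact hi.lintegral_lt_top.ne

lemma tendsto_prod_one_add_div_mul_exp {t : ℝ} (ht : 0 < t) :
    Tendsto (fun n : ℕ => ∏ k ∈ Finset.range n, (1 + t / (k + 1)) * exp (-(t / (k + 1)))) atTop
      (𝓝 (exp (-eulerMascheroniConstant * t) / Gamma (t + 1))) := by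
  have h1 : Tendsto (fun n : ℕ => exp (-((harmonic n : ℝ) - log n) * t) / (t * GammaSeq t n)) atTop
      (𝓝 (exp (-eulerMascheroniConstant * t) / Gamma (t + 1))) := by
    rw [Gamma_add_one ht.ne']
    refine ((continuous_exp.tendsto _).comp (tendsto_harmonic_sub_log.neg.mul_const t)).div
      ((GammaSeq_tendsto_Gamma t).const_mul t) ?_
    have := Gamma_pos_of_pos ht
    positivity
  refine h1.congr' ?_
  filter_upwards [eventually_gt_atTop 0] with n hn
  have hn' : (0 : ℝ) < n := by exact_mod_cast hn
  have hp : ∏ k ∈ Finset.range n, (1 + t / (k + 1)) =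
      (∏ k ∈ Finset.range n, (t + (k + 1))) / (n.factorial : ℝ) := by
    rw [← Finset.prod_range_add_one_eq_factorial, Nat.cast_prod, ← Finset.prod_div_distrib]
    refine Finset.prod_congr rfl fun k _ => ?_
    push_cast
    field_simp
    ring
  have hpos : 0 < ∏ k ∈ Finset.range n, (t + (k + 1)) := Finset.prod_pos fun k _ => by positivity
  rw [Finset.prod_mul_distrib, ← exp_sum, hp, GammaSeq, Finset.prod_range_succ', harmonic,
    rpow_def_of_pos hn']
  have hsum : ∑ k ∈ Finset.range n, -(t / ((k : ℝ) + 1)) =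
      -(((∑ i ∈ Finset.range n, ((i + 1 : ℕ) : ℚ)⁻¹ : ℚ) : ℝ)) * t := by
    push_cast
    rw [← Finset.sum_neg_distrib, Finset.sum_mul]
    refine Finset.sum_congr rfl fun k _ => ?_
    ring
  have he : -(((∑ i ∈ Finset.range n, ((i + 1 : ℕ) : ℚ)⁻¹ : ℚ) : ℝ) - log n) * t =
      -(((∑ i ∈ Finset.range n, ((i + 1 : ℕ) : ℚ)⁻¹ : ℚ) : ℝ)) * t + log n * t := by ring
  rw [hsum, he, exp_add]
  push_cast
  have := hpos.ne'
  have := ht.ne'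
  have := Nat.factorial_ne_zero n
  field_simp
  ring

theorem stmt_15 :
    ∃ μ : Measure ℝ, IsProbabilityMeasure μ ∧ μ (Set.Iio 0) = 0 ∧
      ∀ t : ℝ, 0 ≤ t →
        ∫ ω, Real.exp (-t ^ 2 * ω) ∂μ =
          Real.exp (-Real.eulerMascheroniConstant * t) / Real.Gamma (t + 1) := by
  have : IsProbabilityMeasure (gammaMeasure (3 / 2) 1) :=
    isProbabilityMeasure_gammaMeasure (by norm_num) one_pos
  let P : Measure (ℕ → ℝ) := Measure.infinitePi fun _ => gammaMeasure (3 / 2) 1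
  let f : ℕ → ℝ → ℝ := fun k y => |y|⁻¹ / 4 / ((k : ℝ) + 1) ^ 2
  have hfm : ∀ k, Measurable (f k) := fun k => by fun_prop
  have hf0 : ∀ k y, 0 ≤ f k y := fun k y => by positivity
  have hmp : ∀ k, MeasurePreserving (Function.eval k) P (gammaMeasure (3 / 2) 1) :=
    fun k => measurePreserving_eval_infinitePi _ k
  let X : ℕ → (ℕ → ℝ) → ℝ := fun k ω => f k (ω k)
  have hXm : ∀ k, Measurable (X k) := fun k => (hfm k).comp (measurable_pi_apply k)
  have hindep : iIndepFun X P := iIndepFun_infinitePi hfm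
  have hmgf (t : ℝ) (ht : 0 < t) (k : ℕ) :
      mgf (X k) P (-t ^ 2) = (1 + t / (k + 1)) * exp (-(t / (k + 1))) := by
    rw [← integral_exp_gammaMeasure_three_halves (t := t / (k + 1)) (by positivity),
      ← (hmp k).map_eq, integral_map (hmp k).measurable.aemeasurable
        (Measurable.aestronglyMeasurable (by fun_prop)), mgf]
    refine integral_congr_ae (ae_of_all _ fun ω => ?_)
    simp only [X, f, Function.eval]
    congr 1
    field_simp
  have hsummable : ∀ᵐ ω ∂P, Summable fun k => X k ω := by
    have hfin : ∫⁻ ω, ∑' k, ENNReal.ofReal (X k ω) ∂P ≠ ⊤ := by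
      rw [lintegral_tsum fun k => (hXm k).ennreal_ofReal.aemeasurable]
      have hk (k : ℕ) : ∫⁻ ω, ENNReal.ofReal (X k ω) ∂P =
          ENNReal.ofReal (1 / 4 / ((k : ℝ) + 1) ^ 2) *
            ∫⁻ y, ENNReal.ofReal |y|⁻¹ ∂gammaMeasure (3 / 2) 1 := by
        rw [← lintegral_const_mul _ (by fun_prop), ← (hmp k).lintegral_comp (by fun_prop)]
        refine lintegral_congr fun ω => ?_
        rw [← ENNReal.ofReal_mul (by positivity)]
        simp only [X, f, Function.eval]
        congr 1
        ring
      simp_rw [hk]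
      rw [ENNReal.tsum_mul_right]
      refine ENNReal.mul_ne_top ?_ lintegral_inv_gammaMeasure_ne_top
      have hs : Summable fun k : ℕ => 1 / 4 / ((k : ℝ) + 1) ^ 2 := by
        have := ((summable_nat_add_iff 1).2 (summable_one_div_nat_pow.2 one_lt_two)).mul_left
          (1 / 4 : ℝ)
        refine this.congr fun k => ?_
        push_cast
        ring
      exact hs.tsum_ofReal_ne_top
    filter_upwards [ae_lt_top (Measurable.tsum fun k => (hXm k).ennreal_ofReal) hfin]
      with ω hω
    have := ENNReal.summable_toReal hω.ne
    simpa only [ENNReal.toReal_ofReal (hf0 _ _), X] using this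
  let S : (ℕ → ℝ) → ℝ := fun ω => ∑' k, X k ω
  have htends : ∀ᵐ ω ∂P, Tendsto (fun n => ∑ k ∈ Finset.range n, X k ω) atTop (𝓝 (S ω)) :=
    hsummable.mono fun ω hω => hω.hasSum.tendsto_sum_nat
  have hSm : AEMeasurable S P := aemeasurable_of_tendsto_metrizable_ae atTop
    (fun n => (Finset.measurable_fun_sum _ fun k _ => hXm k).aemeasurable) htends
  have hprob : IsProbabilityMeasure (P.map S) := Measure.isProbabilityMeasure_map hSm
  refine ⟨P.map S, hprob, ?_, fun t ht => ?_⟩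
  · rw [Measure.map_apply_of_aemeasurable hSm measurableSet_Iio]
    convert measure_empty (μ := P)
    refine eq_empty_of_forall_notMem fun ω hω => ?_
    exact (tsum_nonneg fun k => hf0 k (ω k)).not_gt hω
  · rcases ht.eq_or_lt with rfl | ht
    · simp
    rw [integral_map hSm (Measurable.aestronglyMeasurable (by fun_prop))]
    refine tendsto_nhds_unique ?_ (tendsto_prod_one_add_div_mul_exp ht)
    have hprod (n : ℕ) : ∏ k ∈ Finset.range n, (1 + t / (k + 1)) * exp (-(t / (k + 1))) =
        ∫ ω, exp (-t ^ 2 * ∑ k ∈ Finset.range n, X k ω) ∂P := by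
      simp_rw [← hmgf t ht]
      rw [← hindep.mgf_sum hXm, mgf]
      simp
    simp_rw [hprod]
    refine tendsto_integral_of_dominated_convergence (fun _ => 1)
      (fun n => Measurable.aestronglyMeasurable (by fun_prop)) (integrable_const _)
      (fun n => ae_of_all _ fun ω => ?_) ?_
    · rw [norm_of_nonneg (exp_pos _).le, exp_le_one_iff]
      have : 0 ≤ ∑ k ∈ Finset.range n, X k ω := Finset.sum_nonneg fun k _ => hf0 k (ω k)
      nlinarith [mul_nonneg (sq_nonneg t) this]
    · filter_upwards [htends] with ω hω
      exact (continuous_exp.tendsto _).comp (hω.const_mul _)
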